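/- arXiv:2204.00938 — 2 statements merged into one kernel-verified Lean document; each statement's English description precedes it below -/
import Mathlib

section
/- Let ⟨ξ,π⟩ : E ⥤ A × B be a two-sided fibration, let k : A ⥤ C be a Grothendieck opfibration, and let m : B ⥤ D be a Grothendieck fibration. Then the span ⟨k ∘ ξ, m ∘ π⟩ : E ⥤ C × D is a two-sided fibration. (Whiskering of a two-sided fibration with an opfibration and a fibration.) -/
open CategoryTheory

universe w v₁ u₁ v₂ u₂ v₃ u₃ v₄ u₄ v₅ u₅ v₆ u₆

section BasicDefs

variable {E : Type u₁} [Category.{v₁} E] {B : Type u₂} [Category.{v₂} B]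
  {A : Type u₃} [Category.{v₃} A]

/-- `f` is a `π`-opcartesian morphism. -/
def IsOpcartesianMor (π : E ⥤ B) {e e' : E} (f : e ⟶ e') : Prop :=
  ∀ ⦃e'' : E⦄ (g : e ⟶ e'') (w : π.obj e' ⟶ π.obj e''),
    π.map f ≫ w = π.map g → ∃! h : e' ⟶ e'', π.map h = w ∧ f ≫ h = g

/-- `f` is a `π`-cartesian morphism. -/
def IsCartesianMor (π : E ⥤ B) {e' e : E} (f : e' ⟶ e) : Prop :=
  ∀ ⦃e'' : E⦄ (g : e'' ⟶ e) (w : π.obj e'' ⟶ π.obj e'),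
    w ≫ π.map f = π.map g → ∃! h : e'' ⟶ e', π.map h = w ∧ h ≫ f = g

/-- `f` is `π`-vertical, i.e. `π` sends it to an identity. -/
def IsVerticalMor (π : E ⥤ B) {e e' : E} (f : e ⟶ e') : Prop :=
  ∃ h : π.obj e = π.obj e', π.map f = eqToHom h

/-- `π` is a Grothendieck opfibration. -/
def IsGrothendieckOpfib (π : E ⥤ B) : Prop :=
  ∀ (e : E) ⦃b : B⦄ (u : π.obj e ⟶ b),
    ∃ (e' : E) (f : e ⟶ e') (hb : π.obj e' = b),
      IsOpcartesianMor π f ∧ π.map f ≫ eqToHom hb = u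

/-- `π` is a Grothendieck fibration. -/
def IsGrothendieckFib (π : E ⥤ B) : Prop :=
  ∀ (e : E) ⦃b : B⦄ (v : b ⟶ π.obj e),
    ∃ (e' : E) (f : e' ⟶ e) (hb : π.obj e' = b),
      IsCartesianMor π f ∧ eqToHom hb.symm ≫ π.map f = v

/-- `φ` is a cocartesian fibration sliced over the base of `π`. -/
def IsSlicedCocartFib {F : Type u₄} [Category.{v₄} F] (π : E ⥤ B) (φ : F ⥤ E) : Prop :=
  ∀ (x : F) (e : E) (k : φ.obj x ⟶ e), IsVerticalMor π k →
    ∃ (x' : F) (f : x ⟶ x') (he : φ.obj x' = e),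
      IsOpcartesianMor φ f ∧ φ.map f ≫ eqToHom he = k

/-- The span `⟨ξ,π⟩` is cocartesian on the left. -/
def CocartOnLeft (ξ : E ⥤ A) (π : E ⥤ B) : Prop :=
  ∀ (e : E) ⦃a' : A⦄ (u : ξ.obj e ⟶ a'),
    ∃ (e' : E) (f : e ⟶ e') (ha : ξ.obj e' = a'),
      IsOpcartesianMor ξ f ∧ IsVerticalMor π f ∧ ξ.map f ≫ eqToHom ha = u

/-- The span `⟨ξ,π⟩` is cartesian on the right. -/
def CartOnRight (ξ : E ⥤ A) (π : E ⥤ B) : Prop :=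
  ∀ (e : E) ⦃b' : B⦄ (v : b' ⟶ π.obj e),
    ∃ (e' : E) (f : e' ⟶ e) (hb : π.obj e' = b'),
      IsCartesianMor π f ∧ IsVerticalMor ξ f ∧ eqToHom hb.symm ≫ π.map f = v

/-- `f` and `g` lie over the same arrow of the base (up to `eqToHom`). -/
def OverSameArrow (ξ : E ⥤ A) {x y x' y' : E} (f : x ⟶ y) (g : x' ⟶ y') : Prop :=
  ∃ (p : ξ.obj x = ξ.obj x') (q : ξ.obj y = ξ.obj y'),
    ξ.map f ≫ eqToHom q = eqToHom p ≫ ξ.map g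

/-- Cocartesian and cartesian lifts commute: every comparison morphism
`h : u_!(v^* e) ⟶ v^*(u_! e)` is an isomorphism. -/
def LiftsCommute (ξ : E ⥤ A) (π : E ⥤ B) : Prop :=
  ∀ ⦃e e₁ e₂ e₃ e₄ : E⦄ (k : e ⟶ e₁) (k' : e₂ ⟶ e) (f : e₂ ⟶ e₃) (f' : e₄ ⟶ e₁)
    (g : e₃ ⟶ e₁) (h : e₃ ⟶ e₄),
    IsOpcartesianMor ξ k → IsVerticalMor π k →
    IsCartesianMor π k' → IsVerticalMor ξ k' →
    IsOpcartesianMor ξ f → IsVerticalMor π f → OverSameArrow ξ f k →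
    IsCartesianMor π f' → IsVerticalMor ξ f' → OverSameArrow π f' k' →
    IsVerticalMor ξ g → f ≫ g = k' ≫ k →
    IsVerticalMor ξ h → IsVerticalMor π h → h ≫ f' = g →
    IsIso h

/-- Two-sided (cartesian) fibration. -/
def IsTwoSidedFib (ξ : E ⥤ A) (π : E ⥤ B) : Prop :=
  CocartOnLeft ξ π ∧ CartOnRight ξ π ∧ LiftsCommute ξ π

end BasicDefs

section Whiskering

variable {E : Type u₁} [Category.{v₁} E] {A : Type u₂} [Category.{v₂} A]
  {B : Type u₃} [Category.{v₃} B] {C : Type u₄} [Category.{v₄} C]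
  {D : Type u₅} [Category.{v₅} D]

section Vertical

variable {F : E ⥤ A} {x y z x' y' x'' y'' : E}

theorem IsVerticalMor.comp {f : x ⟶ y} {g : y ⟶ z} (hf : IsVerticalMor F f)
    (hg : IsVerticalMor F g) : IsVerticalMor F (f ≫ g) := by
  obtain ⟨p, hp⟩ := hf
  obtain ⟨q, hq⟩ := hg
  exact ⟨p.trans q, by simp [hp, hq]⟩

theorem IsVerticalMor.of_comp_left {f : x ⟶ y} {g : y ⟶ z} (hf : IsVerticalMor F f)
    (hfg : IsVerticalMor F (f ≫ g)) : IsVerticalMor F g := by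
  obtain ⟨p, hp⟩ := hf
  obtain ⟨q, hq⟩ := hfg
  refine ⟨p.symm.trans q, ?_⟩
  rw [← cancel_epi (eqToHom p), ← hp, ← F.map_comp, hq, hp, eqToHom_trans]

theorem IsVerticalMor.of_comp_right {f : x ⟶ y} {g : y ⟶ z} (hg : IsVerticalMor F g)
    (hfg : IsVerticalMor F (f ≫ g)) : IsVerticalMor F f := by
  obtain ⟨p, hp⟩ := hg
  obtain ⟨q, hq⟩ := hfg
  refine ⟨q.trans p.symm, ?_⟩
  rw [← cancel_mono (eqToHom p), ← hp, ← F.map_comp, hq, hp, eqToHom_trans]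

theorem IsVerticalMor.comp_functor {f : x ⟶ y} (hf : IsVerticalMor F f) (G : A ⥤ C) :
    IsVerticalMor (F ⋙ G) f := by
  obtain ⟨p, hp⟩ := hf
  exact ⟨congrArg G.obj p, by simp [hp, eqToHom_map]⟩

theorem IsVerticalMor.map_eq {f g : x ⟶ y} (hf : IsVerticalMor F f) (hg : IsVerticalMor F g) :
    F.map f = F.map g := by
  obtain ⟨p, hp⟩ := hf
  obtain ⟨q, hq⟩ := hg
  rw [hp, hq]

theorem OverSameArrow.symm {f : x ⟶ y} {g : x' ⟶ y'} (h : OverSameArrow F f g) :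
    OverSameArrow F g f := by
  obtain ⟨p, q, h⟩ := h
  refine ⟨p.symm, q.symm, ?_⟩
  rw [← cancel_epi (eqToHom p), ← reassoc_of% h]
  simp

theorem OverSameArrow.trans {f : x ⟶ y} {g : x' ⟶ y'} {k : x'' ⟶ y''}
    (h : OverSameArrow F f g) (h' : OverSameArrow F g k) : OverSameArrow F f k := by
  obtain ⟨p, q, h⟩ := h
  obtain ⟨p', q', h'⟩ := h'
  refine ⟨p.trans p', q.trans q', ?_⟩
  rw [← eqToHom_trans q q', reassoc_of% h, h', eqToHom_trans_assoc]

theorem OverSameArrow.comp_functor {f : x ⟶ y} {g : x' ⟶ y'} (h : OverSameArrow F f g)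
    (G : A ⥤ C) : OverSameArrow (F ⋙ G) f g := by
  obtain ⟨p, q, h⟩ := h
  refine ⟨congrArg G.obj p, congrArg G.obj q, ?_⟩
  simpa [eqToHom_map] using congrArg G.map h

theorem IsVerticalMor.overSameArrow_comp_left {a : x ⟶ y} (ha : IsVerticalMor F a) (f : y ⟶ z) :
    OverSameArrow F (a ≫ f) f := by
  obtain ⟨p, hp⟩ := ha
  exact ⟨p, rfl, by simp [hp]⟩

theorem IsVerticalMor.overSameArrow_comp_right {a : y ⟶ z} (ha : IsVerticalMor F a) (f : x ⟶ y) :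
    OverSameArrow F (f ≫ a) f := by
  obtain ⟨p, hp⟩ := ha
  exact ⟨rfl, p.symm, by simp [hp]⟩

end Vertical

section Opcartesian

variable {F : E ⥤ A} {x y z x' y' : E}

theorem isOpcartesianMor_of_isIso (F : E ⥤ A) (f : x ⟶ y) [IsIso f] : IsOpcartesianMor F f := by
  intro e g w hw
  refine ⟨inv f ≫ g, ⟨by simp [← hw], by simp⟩, ?_⟩
  rintro h ⟨-, rfl⟩
  simp

theorem IsOpcartesianMor.comp {f : x ⟶ y} {g : y ⟶ z} (hf : IsOpcartesianMor F f)
    (hg : IsOpcartesianMor F g) : IsOpcartesianMor F (f ≫ g) := by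
  intro e t w hw
  obtain ⟨h₁, ⟨h₁m, h₁c⟩, h₁u⟩ := hf t (F.map g ≫ w) (by simpa using hw)
  obtain ⟨h₂, ⟨h₂m, h₂c⟩, h₂u⟩ := hg h₁ w h₁m.symm
  refine ⟨h₂, ⟨h₂m, by simp [h₂c, h₁c]⟩, ?_⟩
  rintro h ⟨hm, hc⟩
  exact h₂u h ⟨hm, h₁u _ ⟨by simp [hm], by simpa using hc⟩⟩

theorem IsOpcartesianMor.comp_functor {G : A ⥤ C} {f : x ⟶ y} (hf : IsOpcartesianMor F f)
    (hG : IsOpcartesianMor G (F.map f)) : IsOpcartesianMor (F ⋙ G) f := by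
  intro e g w hw
  obtain ⟨w', ⟨w'm, w'c⟩, w'u⟩ := hG (F.map g) w hw
  obtain ⟨h, ⟨hm, hc⟩, hu⟩ := hf g w' w'c
  refine ⟨h, ⟨by simp [hm, w'm], hc⟩, ?_⟩
  rintro h' ⟨h'm, h'c⟩
  exact hu h' ⟨w'u _ ⟨h'm, by rw [← F.map_comp, h'c]⟩, h'c⟩

theorem IsOpcartesianMor.map_of_overSameArrow {G : A ⥤ C} {f : x ⟶ y} {g : x' ⟶ y'}
    (hf : IsOpcartesianMor G (F.map f)) (h : OverSameArrow F g f) :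
    IsOpcartesianMor G (F.map g) := by
  obtain ⟨p, q, h⟩ := h
  have : F.map g = eqToHom p ≫ F.map f ≫ eqToHom q.symm := by
    rw [← reassoc_of% h]
    simp
  rw [this]
  exact (isOpcartesianMor_of_isIso G _).comp (hf.comp (isOpcartesianMor_of_isIso G _))

theorem IsOpcartesianMor.exists_vertical {f : x ⟶ y} (hf : IsOpcartesianMor F f) {g : x ⟶ z}
    (h : OverSameArrow F f g) : ∃ i : y ⟶ z, IsVerticalMor F i ∧ f ≫ i = g := by
  obtain ⟨p, q, h⟩ := h
  obtain ⟨i, ⟨hi, hc⟩, -⟩ := hf g (eqToHom q) (by simpa using h)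
  exact ⟨i, ⟨q, hi⟩, hc⟩

theorem IsOpcartesianMor.hom_ext {f : x ⟶ y} (hf : IsOpcartesianMor F f) {i j : y ⟶ z}
    (hi : IsVerticalMor F i) (hj : IsVerticalMor F j) (h : f ≫ i = f ≫ j) : i = j :=
  (hf (f ≫ j) (F.map j) (by simp)).unique ⟨hi.map_eq hj, h⟩ ⟨rfl, rfl⟩

theorem IsOpcartesianMor.exists_vertical_isIso {f : x ⟶ y} (hf : IsOpcartesianMor F f) {g : x ⟶ z}
    (hg : IsOpcartesianMor F g) (h : OverSameArrow F f g) :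
    ∃ i : y ⟶ z, IsIso i ∧ IsVerticalMor F i ∧ f ≫ i = g := by
  obtain ⟨i, hi, hfi⟩ := hf.exists_vertical h
  obtain ⟨j, hj, hgj⟩ := hg.exists_vertical h.symm
  refine ⟨i, ⟨j, ?_, ?_⟩, hi, hfi⟩
  · exact hf.hom_ext (hi.comp hj) ⟨rfl, by simp⟩ (by rw [reassoc_of% hfi, hgj, Category.comp_id])
  · exact hg.hom_ext (hj.comp hi) ⟨rfl, by simp⟩ (by rw [reassoc_of% hgj, hfi, Category.comp_id])

end Opcartesian

section Cartesian

variable {F : E ⥤ A} {x y z x' y' : E}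

theorem isCartesianMor_of_isIso (F : E ⥤ A) (f : x ⟶ y) [IsIso f] : IsCartesianMor F f := by
  intro e g w hw
  refine ⟨g ≫ inv f, ⟨by simp [← hw], by simp⟩, ?_⟩
  rintro h ⟨-, rfl⟩
  simp

theorem IsCartesianMor.comp {f : x ⟶ y} {g : y ⟶ z} (hf : IsCartesianMor F f)
    (hg : IsCartesianMor F g) : IsCartesianMor F (f ≫ g) := by
  intro e t w hw
  obtain ⟨h₁, ⟨h₁m, h₁c⟩, h₁u⟩ := hg t (w ≫ F.map f) (by simpa using hw)
  obtain ⟨h₂, ⟨h₂m, h₂c⟩, h₂u⟩ := hf h₁ w h₁m.symm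
  refine ⟨h₂, ⟨h₂m, by simp [reassoc_of% h₂c, h₁c]⟩, ?_⟩
  rintro h ⟨hm, hc⟩
  exact h₂u h ⟨hm, h₁u _ ⟨by simp [hm], by simpa using hc⟩⟩

theorem IsCartesianMor.comp_functor {G : A ⥤ C} {f : x ⟶ y} (hf : IsCartesianMor F f)
    (hG : IsCartesianMor G (F.map f)) : IsCartesianMor (F ⋙ G) f := by
  intro e g w hw
  obtain ⟨w', ⟨w'm, w'c⟩, w'u⟩ := hG (F.map g) w hw
  obtain ⟨h, ⟨hm, hc⟩, hu⟩ := hf g w' w'c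
  refine ⟨h, ⟨by simp [hm, w'm], hc⟩, ?_⟩
  rintro h' ⟨h'm, h'c⟩
  exact hu h' ⟨w'u _ ⟨h'm, by rw [← F.map_comp, h'c]⟩, h'c⟩

theorem IsCartesianMor.map_of_overSameArrow {G : A ⥤ C} {f : x ⟶ y} {g : x' ⟶ y'}
    (hf : IsCartesianMor G (F.map f)) (h : OverSameArrow F g f) :
    IsCartesianMor G (F.map g) := by
  obtain ⟨p, q, h⟩ := h
  have : F.map g = eqToHom p ≫ F.map f ≫ eqToHom q.symm := by
    rw [← reassoc_of% h]
    simp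
  rw [this]
  exact (isCartesianMor_of_isIso G _).comp (hf.comp (isCartesianMor_of_isIso G _))

theorem IsCartesianMor.exists_vertical {f : y ⟶ x} (hf : IsCartesianMor F f) {g : z ⟶ x}
    (h : OverSameArrow F g f) : ∃ i : z ⟶ y, IsVerticalMor F i ∧ i ≫ f = g := by
  obtain ⟨p, q, h⟩ := h
  obtain ⟨i, ⟨hi, hc⟩, -⟩ := hf g (eqToHom p) (by simpa using h.symm)
  exact ⟨i, ⟨p, hi⟩, hc⟩

theorem IsCartesianMor.hom_ext {f : y ⟶ x} (hf : IsCartesianMor F f) {i j : z ⟶ y}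
    (hi : IsVerticalMor F i) (hj : IsVerticalMor F j) (h : i ≫ f = j ≫ f) : i = j :=
  (hf (j ≫ f) (F.map j) (by simp)).unique ⟨hi.map_eq hj, h⟩ ⟨rfl, rfl⟩

theorem IsCartesianMor.exists_vertical_isIso {f : y ⟶ x} (hf : IsCartesianMor F f) {g : z ⟶ x}
    (hg : IsCartesianMor F g) (h : OverSameArrow F g f) :
    ∃ i : z ⟶ y, IsIso i ∧ IsVerticalMor F i ∧ i ≫ f = g := by
  obtain ⟨i, hi, hif⟩ := hf.exists_vertical h
  obtain ⟨j, hj, hjg⟩ := hg.exists_vertical h.symm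
  refine ⟨i, ⟨j, ?_, ?_⟩, hi, hif⟩
  · exact hg.hom_ext (hi.comp hj) ⟨rfl, by simp⟩ (by simp [hjg, hif])
  · exact hf.hom_ext (hj.comp hi) ⟨rfl, by simp⟩ (by simp [hjg, hif])

end Cartesian

/-- Compatible choices of lifts along `f : e ⟶ e₁` and `g : e₂ ⟶ e` for which the comparison
morphism is an isomorphism. -/
def HasCommutingLifts (ξ : E ⥤ A) (π : E ⥤ B) {e e₁ e₂ : E} (f : e ⟶ e₁) (g : e₂ ⟶ e) : Prop :=
  ∃ (e₃ e₄ : E) (f' : e₂ ⟶ e₃) (g' : e₄ ⟶ e₁) (h : e₃ ⟶ e₄),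
    IsOpcartesianMor ξ f' ∧ IsVerticalMor π f' ∧ OverSameArrow ξ f' f ∧
    IsCartesianMor π g' ∧ IsVerticalMor ξ g' ∧ OverSameArrow π g' g ∧
    IsVerticalMor ξ h ∧ IsVerticalMor π h ∧ f' ≫ h ≫ g' = g ≫ f ∧ IsIso h

theorem IsTwoSidedFib.hasCommutingLifts {ξ : E ⥤ A} {π : E ⥤ B} (H : IsTwoSidedFib ξ π)
    {e e₁ e₂ : E} {f : e ⟶ e₁} {g : e₂ ⟶ e} (hf : IsOpcartesianMor ξ f) (hfπ : IsVerticalMor π f)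
    (hg : IsCartesianMor π g) (hgξ : IsVerticalMor ξ g) : HasCommutingLifts ξ π f g := by
  obtain ⟨hl, hr, hc⟩ := H
  obtain ⟨p, -⟩ := id hgξ
  obtain ⟨q, -⟩ := id hfπ
  obtain ⟨e₃, f', r, hf', hf'π, hf'f⟩ := hl e₂ (eqToHom p ≫ ξ.map f)
  obtain ⟨e₄, g', s, hg', hg'ξ, hg'g⟩ := hr e₁ (π.map g ≫ eqToHom q)
  have hff : OverSameArrow ξ f' f := ⟨p, r, hf'f⟩
  have hgg : OverSameArrow π g' g :=
    ⟨s, q.symm, by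
      rw [← cancel_epi (eqToHom s.symm), reassoc_of% hg'g]
      simp⟩
  obtain ⟨t, htξ, ht⟩ := hf'.exists_vertical (hff.trans (hgξ.overSameArrow_comp_left f).symm)
  have htg : OverSameArrow π t g' :=
    (hf'π.overSameArrow_comp_left t).symm.trans
      (ht ▸ (hfπ.overSameArrow_comp_right g).trans hgg.symm)
  obtain ⟨h, hhπ, hh⟩ := hg'.exists_vertical htg
  have hhξ : IsVerticalMor ξ h := hg'ξ.of_comp_right (hh ▸ htξ)
  exact ⟨e₃, e₄, f', g', h, hf', hf'π, hff, hg', hg'ξ, hgg, hhξ, hhπ, by rw [hh, ht],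
    hc f g f' g' t h hf hfπ hg hgξ hf' hf'π hff hg' hg'ξ hgg htξ ht hhξ hhπ hh⟩

/-- Whether lifts commute may be tested on one choice of lifts. -/
theorem liftsCommute_of_hasCommutingLifts {ξ : E ⥤ A} {π : E ⥤ B}
    (H : ∀ {e e₁ e₂ : E} (f : e ⟶ e₁) (g : e₂ ⟶ e), ∃ (d₁ d₂ : E) (f₀ : e ⟶ d₁) (g₀ : d₂ ⟶ e),
      IsOpcartesianMor ξ f₀ ∧ IsVerticalMor π f₀ ∧ OverSameArrow ξ f₀ f ∧
      IsCartesianMor π g₀ ∧ IsVerticalMor ξ g₀ ∧ OverSameArrow π g₀ g ∧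
      HasCommutingLifts ξ π f₀ g₀) :
    LiftsCommute ξ π := by
  intro e e₁ e₂ e₃ e₄ k k' f f' g h hk hkπ hk' hk'ξ hf hfπ hfk hf' hf'ξ hfk' hgξ hg hhξ hhπ hh
  obtain ⟨d₁, d₂, n, n', hn, hnπ, hnk, hn', hn'ξ, hnk', d₃, d₄, l, l', h₀, hl, hlπ, hln,
    hl', hl'ξ, hln', hh₀ξ, hh₀π, hh₀, hiso⟩ := H k k'
  obtain ⟨i₁, hi₁, hi₁ξ, hni⟩ := hn.exists_vertical_isIso hk hnk
  obtain ⟨i₂, hi₂, hi₂π, hin⟩ := hn'.exists_vertical_isIso hk' hnk'.symm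
  have hi₁π : IsVerticalMor π i₁ := hnπ.of_comp_left (hni ▸ hkπ)
  have hi₂ξ : IsVerticalMor ξ i₂ := hn'ξ.of_comp_right (hin ▸ hk'ξ)
  obtain ⟨i₃, hi₃, hi₃ξ, hfi⟩ := hf.exists_vertical_isIso
    ((isOpcartesianMor_of_isIso ξ i₂).comp hl)
    (hfk.trans (hnk.symm.trans (hln.symm.trans (hi₂ξ.overSameArrow_comp_left l).symm)))
  obtain ⟨i₄, hi₄, hi₄π, hif⟩ := hf'.exists_vertical_isIso
    (hl'.comp (isCartesianMor_of_isIso π i₁))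
    ((hi₁π.overSameArrow_comp_right l').trans (hln'.trans (hnk'.trans hfk'.symm)))
  have hi₃π : IsVerticalMor π i₃ := hfπ.of_comp_left (hfi ▸ hi₂π.comp hlπ)
  have hi₄ξ : IsVerticalMor ξ i₄ := hf'ξ.of_comp_right (hif ▸ hl'ξ.comp hi₁ξ)
  have hcomp : h = i₃ ≫ h₀ ≫ i₄ := by
    refine hf'.hom_ext hhπ (hi₃π.comp (hh₀π.comp hi₄π)) ?_
    refine hf.hom_ext (hh ▸ hgξ) ((hi₃ξ.comp (hh₀ξ.comp hi₄ξ)).comp hf'ξ) ?_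
    simp only [Category.assoc]
    rw [hh, hg, hif, reassoc_of% hfi, reassoc_of% hh₀, hni, reassoc_of% hin]
  rw [hcomp]
  infer_instance

theorem CocartOnLeft.exists_lift_comp {ξ : E ⥤ A} {π : E ⥤ B} {k : A ⥤ C} (H : CocartOnLeft ξ π)
    (hk : IsGrothendieckOpfib k) (e : E) {c : C} (u : k.obj (ξ.obj e) ⟶ c) :
    ∃ (e' : E) (f : e ⟶ e') (hc : k.obj (ξ.obj e') = c),
      IsOpcartesianMor ξ f ∧ IsOpcartesianMor k (ξ.map f) ∧ IsVerticalMor π f ∧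
      k.map (ξ.map f) ≫ eqToHom hc = u := by
  obtain ⟨a, t, rfl, ht, rfl⟩ := hk _ u
  obtain ⟨e', f, rfl, hf, hfπ, rfl⟩ := H e t
  exact ⟨e', f, rfl, hf, by simpa using ht, hfπ, by simp⟩

theorem CartOnRight.exists_lift_comp {ξ : E ⥤ A} {π : E ⥤ B} {m : B ⥤ D} (H : CartOnRight ξ π)
    (hm : IsGrothendieckFib m) (e : E) {d : D} (v : d ⟶ m.obj (π.obj e)) :
    ∃ (e' : E) (f : e' ⟶ e) (hd : m.obj (π.obj e') = d),
      IsCartesianMor π f ∧ IsCartesianMor m (π.map f) ∧ IsVerticalMor ξ f ∧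
      eqToHom hd.symm ≫ m.map (π.map f) = v := by
  obtain ⟨b, t, rfl, ht, rfl⟩ := hm _ v
  obtain ⟨e', f, rfl, hf, hfξ, rfl⟩ := H e t
  exact ⟨e', f, rfl, hf, by simpa using ht, hfξ, by simp⟩

end Whiskering

section Statement11

variable {E : Type u₁} [Category.{v₁} E] {A : Type u₂} [Category.{v₂} A]
  {B : Type u₃} [Category.{v₃} B] {C : Type u₄} [Category.{v₄} C]
  {D : Type u₅} [Category.{v₅} D]

/-- **Whiskering.** If `⟨ξ,π⟩ : E ⥤ A × B` is a two-sided fibration, `k : A ⥤ C` is a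
Grothendieck opfibration and `m : B ⥤ D` is a Grothendieck fibration, then
`⟨k ∘ ξ, m ∘ π⟩ : E ⥤ C × D` is a two-sided fibration. -/
theorem isTwoSidedFib_whisker
    (ξ : E ⥤ A) (π : E ⥤ B) (k : A ⥤ C) (m : B ⥤ D)
    (hξπ : IsTwoSidedFib ξ π) (hk : IsGrothendieckOpfib k) (hm : IsGrothendieckFib m) :
    IsTwoSidedFib (ξ ⋙ k) (π ⋙ m) := by
  obtain ⟨hl, hr, -⟩ := id hξπ
  refine ⟨fun e c u => ?_, fun e d v => ?_, liftsCommute_of_hasCommutingLifts fun {e _ _} f g => ?_⟩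
  · obtain ⟨e', f, hc, hf, hkf, hfπ, hu⟩ := hl.exists_lift_comp hk e u
    exact ⟨e', f, hc, hf.comp_functor hkf, hfπ.comp_functor m, hu⟩
  · obtain ⟨e', f, hd, hf, hmf, hfξ, hv⟩ := hr.exists_lift_comp hm e v
    exact ⟨e', f, hd, hf.comp_functor hmf, hfξ.comp_functor k, hv⟩
  · obtain ⟨d₁, n, hc, hn, hkn, hnπ, hnf⟩ := hl.exists_lift_comp hk e (k.map (ξ.map f))
    obtain ⟨d₂, n', hd, hn', hmn', hn'ξ, hng⟩ := hr.exists_lift_comp hm e (m.map (π.map g))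
    obtain ⟨d₃, d₄, l, l', h, hl, hlπ, hln, hl', hl'ξ, hln', hhξ, hhπ, hh, hiso⟩ :=
      hξπ.hasCommutingLifts hn hnπ hn' hn'ξ
    exact ⟨d₁, d₂, n, n', hn.comp_functor hkn, hnπ.comp_functor m, ⟨rfl, hc, by simpa using hnf⟩,
      hn'.comp_functor hmn', hn'ξ.comp_functor k, ⟨hd, rfl, by simp [← hng]⟩,
      d₃, d₄, l, l', h, hl.comp_functor (hkn.map_of_overSameArrow hln), hlπ.comp_functor m,
      hln.comp_functor k, hl'.comp_functor (hmn'.map_of_overSameArrow hln'),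
      hl'ξ.comp_functor k, hln'.comp_functor m, hhξ.comp_functor k, hhπ.comp_functor m, hh, hiso⟩

end Statement11
end

section
/- Let ⟨ξ,π⟩ : E ⥤ A × B be a two-sided fibration and let k : C ⥤ A and m : D ⥤ B be functors. Let E' be the category whose objects are triples (c, d, e) with c in C, d in D, e in E, ξ e = k c and π e = m d, and whose morphisms (c,d,e) → (c',d',e') are triples (γ : c → c', δ : d → d', μ : e → e') with ξ μ = k γ and π μ = m δ. Then the span ⟨pr_C, pr_D⟩ : E' ⥤ C × D is a two-sided fibration, and the projection E' ⥤ E, together with k and m, is a two-sided cartesian functor. (Pullback stability of two-sided fibrations.) -/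
open CategoryTheory

universe w v₁ u₁ v₂ u₂ v₃ u₃ v₄ u₄ v₅ u₅ v₆ u₆

section Statement13

/-- A two-sided cartesian functor between spans, over base functors `j` and `l`. -/
def IsTwoSidedCartFunctor
    {E : Type u₁} [Category.{v₁} E] {A : Type u₂} [Category.{v₂} A]
    {B : Type u₃} [Category.{v₃} B]
    {E' : Type u₄} [Category.{v₄} E'] {A' : Type u₅} [Category.{v₅} A']
    {B' : Type u₆} [Category.{v₆} B']
    (ξ : E ⥤ A) (π : E ⥤ B) (ξ' : E' ⥤ A') (π' : E' ⥤ B')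
    (j : A ⥤ A') (l : B ⥤ B') (Φ : E ⥤ E') : Prop :=
  ξ ⋙ j = Φ ⋙ ξ' ∧ π ⋙ l = Φ ⋙ π' ∧
  (∀ ⦃x y : E⦄ (f : x ⟶ y), IsOpcartesianMor ξ f → IsOpcartesianMor ξ' (Φ.map f)) ∧
  (∀ ⦃x y : E⦄ (f : x ⟶ y), IsCartesianMor π f → IsCartesianMor π' (Φ.map f))

variable {E : Type u₁} [Category.{v₁} E] {A : Type u₂} [Category.{v₂} A]
  {B : Type u₃} [Category.{v₃} B] {C : Type u₄} [Category.{v₄} C]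
  {D : Type u₅} [Category.{v₅} D]

/-- The (strict) pullback of a span `⟨ξ,π⟩ : E ⥤ A × B` along `k : C ⥤ A` and
`m : D ⥤ B`: objects are triples `(c, d, e)` with `ξ e = k c` and `π e = m d`. -/
structure SpanPullback (ξ : E ⥤ A) (π : E ⥤ B) (k : C ⥤ A) (m : D ⥤ B) :
    Type max u₁ u₄ u₅ where
  c : C
  d : D
  e : E
  hc : ξ.obj e = k.obj c
  hd : π.obj e = m.obj d

/-- Morphisms in the pullback: triples `(γ, δ, μ)` with `ξ μ = k γ` and `π μ = m δ`. -/
structure SpanPullbackHom {ξ : E ⥤ A} {π : E ⥤ B} {k : C ⥤ A} {m : D ⥤ B}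
    (X Y : SpanPullback ξ π k m) where
  γ : X.c ⟶ Y.c
  δ : X.d ⟶ Y.d
  μ : X.e ⟶ Y.e
  wc : ξ.map μ ≫ eqToHom Y.hc = eqToHom X.hc ≫ k.map γ
  wd : π.map μ ≫ eqToHom Y.hd = eqToHom X.hd ≫ m.map δ

variable {ξ : E ⥤ A} {π : E ⥤ B} {k : C ⥤ A} {m : D ⥤ B}

theorem SpanPullbackHom.ext' {X Y : SpanPullback ξ π k m} {f g : SpanPullbackHom X Y}
    (h1 : f.γ = g.γ) (h2 : f.δ = g.δ) (h3 : f.μ = g.μ) : f = g := by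
  cases f; cases g; cases h1; cases h2; cases h3; rfl

instance : Category (SpanPullback ξ π k m) where
  Hom := SpanPullbackHom
  id X := ⟨𝟙 X.c, 𝟙 X.d, 𝟙 X.e, by simp, by simp⟩
  comp f g := ⟨f.γ ≫ g.γ, f.δ ≫ g.δ, f.μ ≫ g.μ,
    by rw [Functor.map_comp, Functor.map_comp, Category.assoc, g.wc, ← Category.assoc,
      f.wc, Category.assoc],
    by rw [Functor.map_comp, Functor.map_comp, Category.assoc, g.wd, ← Category.assoc,
      f.wd, Category.assoc]⟩
  id_comp f := SpanPullbackHom.ext' (by simp) (by simp) (by simp)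
  comp_id f := SpanPullbackHom.ext' (by simp) (by simp) (by simp)
  assoc f g h := SpanPullbackHom.ext' (by simp) (by simp) (by simp)

/-- Projection of the pullback to `C`. -/
def spanPbFstC (ξ : E ⥤ A) (π : E ⥤ B) (k : C ⥤ A) (m : D ⥤ B) :
    SpanPullback ξ π k m ⥤ C where
  obj X := X.c
  map f := f.γ
  map_id _ := rfl
  map_comp _ _ := rfl

/-- Projection of the pullback to `D`. -/
def spanPbSndD (ξ : E ⥤ A) (π : E ⥤ B) (k : C ⥤ A) (m : D ⥤ B) :
    SpanPullback ξ π k m ⥤ D where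
  obj X := X.d
  map f := f.δ
  map_id _ := rfl
  map_comp _ _ := rfl

/-- Projection of the pullback to `E`. -/
def spanPbProjE (ξ : E ⥤ A) (π : E ⥤ B) (k : C ⥤ A) (m : D ⥤ B) :
    SpanPullback ξ π k m ⥤ E where
  obj X := X.e
  map f := f.μ
  map_id _ := rfl
  map_comp _ _ := rfl

@[simp]
theorem spanPullback_comp_γ {X Y Z : SpanPullback ξ π k m} (f : X ⟶ Y) (g : Y ⟶ Z) :
    SpanPullbackHom.γ (f ≫ g) = f.γ ≫ g.γ := rfl

@[simp]
theorem spanPullback_comp_δ {X Y Z : SpanPullback ξ π k m} (f : X ⟶ Y) (g : Y ⟶ Z) :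
    SpanPullbackHom.δ (f ≫ g) = f.δ ≫ g.δ := rfl

@[simp]
theorem spanPullback_comp_μ {X Y Z : SpanPullback ξ π k m} (f : X ⟶ Y) (g : Y ⟶ Z) :
    SpanPullbackHom.μ (f ≫ g) = f.μ ≫ g.μ := rfl

theorem SpanPullbackHom.map_μ_left {X Y : SpanPullback ξ π k m} (f : X ⟶ Y) :
    ξ.map f.μ = eqToHom X.hc ≫ k.map f.γ ≫ eqToHom Y.hc.symm := by
  rw [← Category.assoc, ← f.wc]; simp

theorem SpanPullbackHom.map_μ_right {X Y : SpanPullback ξ π k m} (f : X ⟶ Y) :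
    π.map f.μ = eqToHom X.hd ≫ m.map f.δ ≫ eqToHom Y.hd.symm := by
  rw [← Category.assoc, ← f.wd]; simp

theorem SpanPullbackHom.isIso {X Y : SpanPullback ξ π k m} (f : X ⟶ Y)
    [IsIso f.γ] [IsIso f.δ] [IsIso f.μ] : IsIso f := by
  let g : Y ⟶ X :=
    { γ := inv f.γ
      δ := inv f.δ
      μ := inv f.μ
      wc := by
        rw [Functor.map_inv, IsIso.inv_comp_eq, ← Category.assoc, f.wc]; simp
      wd := by
        rw [Functor.map_inv, IsIso.inv_comp_eq, ← Category.assoc, f.wd]; simp }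
  exact ⟨g, SpanPullbackHom.ext' (IsIso.hom_inv_id f.γ) (IsIso.hom_inv_id f.δ)
    (IsIso.hom_inv_id f.μ), SpanPullbackHom.ext' (IsIso.inv_hom_id f.γ)
    (IsIso.inv_hom_id f.δ) (IsIso.inv_hom_id f.μ)⟩

theorem IsVerticalMor.isIso_map {π : E ⥤ B} {x y : E} {f : x ⟶ y}
    (hf : IsVerticalMor π f) : IsIso (π.map f) := by
  obtain ⟨h, hf⟩ := hf
  rw [hf]
  infer_instance

theorem IsOpcartesianMor.comp_isIso {π : E ⥤ B} {x y z : E} {f : x ⟶ y}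
    (hf : IsOpcartesianMor π f) (i : y ⟶ z) [IsIso i] : IsOpcartesianMor π (f ≫ i) := by
  intro t g w hw
  obtain ⟨h, ⟨h₁, h₂⟩, hu⟩ := hf g (π.map i ≫ w) (by simpa using hw)
  refine ⟨inv i ≫ h, ⟨by simp [h₁], by simp [h₂]⟩, ?_⟩
  rintro h' ⟨h₁', h₂'⟩
  rw [IsIso.eq_inv_comp]
  exact hu _ ⟨by simp [h₁'], by simpa using h₂'⟩

theorem IsCartesianMor.isIso_comp {π : E ⥤ B} {x y z : E} {f : y ⟶ z}
    (hf : IsCartesianMor π f) (i : x ⟶ y) [IsIso i] : IsCartesianMor π (i ≫ f) := by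
  intro t g w hw
  obtain ⟨h, ⟨h₁, h₂⟩, hu⟩ := hf g (w ≫ π.map i) (by simpa using hw)
  refine ⟨h ≫ inv i, ⟨by simp [h₁], by simp [h₂]⟩, ?_⟩
  rintro h' ⟨h₁', h₂'⟩
  rw [IsIso.eq_comp_inv]
  exact hu _ ⟨by simp [h₁'], by simpa using h₂'⟩

theorem IsOpcartesianMor.hom_ext_s12 {π : E ⥤ B} {x y z : E} {f : x ⟶ y}
    (hf : IsOpcartesianMor π f) {g g' : y ⟶ z} (h : π.map g = π.map g')
    (h' : f ≫ g = f ≫ g') : g = g' :=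
  (hf (f ≫ g') (π.map g') (by simp)).unique ⟨h, h'⟩ ⟨rfl, rfl⟩

theorem IsCartesianMor.hom_ext_s12 {π : E ⥤ B} {x y z : E} {f : y ⟶ z}
    (hf : IsCartesianMor π f) {g g' : x ⟶ y} (h : π.map g = π.map g')
    (h' : g ≫ f = g' ≫ f) : g = g' :=
  (hf (g' ≫ f) (π.map g') (by simp)).unique ⟨h, h'⟩ ⟨rfl, rfl⟩

/-- Two opcartesian morphisms with the same source over the same arrow differ by an
isomorphism. -/
theorem IsOpcartesianMor.exists_isIso {π : E ⥤ B} {x y z : E} {f : x ⟶ y} {g : x ⟶ z}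
    (hf : IsOpcartesianMor π f) (hg : IsOpcartesianMor π g) (e : π.obj y = π.obj z)
    (h : π.map f ≫ eqToHom e = π.map g) : ∃ i : y ⟶ z, IsIso i ∧ f ≫ i = g := by
  obtain ⟨i, ⟨hi, hi'⟩, -⟩ := hf g (eqToHom e) h
  obtain ⟨j, ⟨hj, hj'⟩, -⟩ := hg f (eqToHom e.symm) (by simp [← h])
  refine ⟨i, ⟨j, hf.hom_ext_s12 ?_ ?_, hg.hom_ext_s12 ?_ ?_⟩, hi'⟩
  · simp [hi, hj]
  · simp [reassoc_of% hi', hj']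
  · simp [hi, hj]
  · simp [reassoc_of% hj', hi']

/-- Two cartesian morphisms with the same target over the same arrow differ by an
isomorphism. -/
theorem IsCartesianMor.exists_isIso {π : E ⥤ B} {x y z : E} {f : y ⟶ x} {g : z ⟶ x}
    (hf : IsCartesianMor π f) (hg : IsCartesianMor π g) (e : π.obj z = π.obj y)
    (h : eqToHom e ≫ π.map f = π.map g) : ∃ i : z ⟶ y, IsIso i ∧ i ≫ f = g := by
  obtain ⟨i, ⟨hi, hi'⟩, -⟩ := hf g (eqToHom e) h
  obtain ⟨j, ⟨hj, hj'⟩, -⟩ := hg f (eqToHom e.symm) (by simp [← h])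
  refine ⟨i, ⟨j, hg.hom_ext_s12 ?_ ?_, hf.hom_ext_s12 ?_ ?_⟩, hi'⟩
  · simp [hi, hj]
  · simp [hi', hj']
  · simp [hi, hj]
  · simp [hj', hi']

theorem isOpcartesianMor_spanPbFstC {X Y : SpanPullback ξ π k m} (f : X ⟶ Y)
    (hf : IsOpcartesianMor ξ f.μ) [IsIso f.δ] :
    IsOpcartesianMor (spanPbFstC ξ π k m) f := by
  intro Z g w hw
  change Y.c ⟶ Z.c at w
  change f.γ ≫ w = g.γ at hw
  obtain ⟨h, ⟨h₁, h₂⟩, hu⟩ := hf g.μ (eqToHom Y.hc ≫ k.map w ≫ eqToHom Z.hc.symm) (by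
    simp [SpanPullbackHom.map_μ_left, ← hw])
  have hπ : IsIso (π.map f.μ) := by rw [SpanPullbackHom.map_μ_right]; infer_instance
  refine ⟨{ γ := w, δ := inv f.δ ≫ g.δ, μ := h, wc := by simp [h₁], wd := ?_ }, ⟨rfl,
    SpanPullbackHom.ext' hw (by simp) h₂⟩, ?_⟩
  · rw [← cancel_epi (π.map f.μ), ← Category.assoc, ← Functor.map_comp, h₂, g.wd,
      reassoc_of% f.wd]
    simp
  · rintro h' ⟨h₁', rfl⟩
    change h'.γ = w at h₁'
    exact SpanPullbackHom.ext' h₁' (by simp)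
      (hu _ ⟨by rw [SpanPullbackHom.map_μ_left, h₁'], rfl⟩)

theorem isCartesianMor_spanPbSndD {X Y : SpanPullback ξ π k m} (f : X ⟶ Y)
    (hf : IsCartesianMor π f.μ) [IsIso f.γ] :
    IsCartesianMor (spanPbSndD ξ π k m) f := by
  intro Z g w hw
  change Z.d ⟶ X.d at w
  change w ≫ f.δ = g.δ at hw
  obtain ⟨h, ⟨h₁, h₂⟩, hu⟩ := hf g.μ (eqToHom Z.hd ≫ m.map w ≫ eqToHom X.hd.symm) (by
    simp [SpanPullbackHom.map_μ_right, ← hw])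
  refine ⟨{ γ := g.γ ≫ inv f.γ, δ := w, μ := h, wc := ?_, wd := by simp [h₁] }, ⟨rfl,
    SpanPullbackHom.ext' (by simp) hw h₂⟩, ?_⟩
  · rw [← cancel_mono (k.map f.γ), Category.assoc, ← f.wc, ← Category.assoc,
      ← Functor.map_comp, h₂, g.wc]
    simp
  · rintro h' ⟨h₁', rfl⟩
    change h'.δ = w at h₁'
    exact SpanPullbackHom.ext' (by simp) h₁'
      (hu _ ⟨by rw [SpanPullbackHom.map_μ_right, h₁'], rfl⟩)

/-- Opcartesian lifts in the pullback that are inherited from the original span. -/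
theorem CocartOnLeft.exists_lift (hs : CocartOnLeft ξ π) (X : SpanPullback ξ π k m) {c : C}
    (u : X.c ⟶ c) :
    ∃ (Y : SpanPullback ξ π k m) (f : X ⟶ Y) (hc : Y.c = c) (hd : X.d = Y.d),
      IsOpcartesianMor ξ f.μ ∧ f.δ = eqToHom hd ∧ f.γ ≫ eqToHom hc = u := by
  obtain ⟨e, f, ha, hf, ⟨hb, hv⟩, hu⟩ := hs X.e (eqToHom X.hc ≫ k.map u)
  exact ⟨⟨c, X.d, e, ha, hb.symm.trans X.hd⟩,
    { γ := u, δ := 𝟙 _, μ := f, wc := hu, wd := by simp [hv] }, rfl, rfl, hf, rfl, by simp⟩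

/-- Cartesian lifts in the pullback that are inherited from the original span. -/
theorem CartOnRight.exists_lift (hs : CartOnRight ξ π) (X : SpanPullback ξ π k m) {d : D}
    (v : d ⟶ X.d) :
    ∃ (Y : SpanPullback ξ π k m) (f : Y ⟶ X) (hd : Y.d = d) (hc : Y.c = X.c),
      IsCartesianMor π f.μ ∧ f.γ = eqToHom hc ∧ eqToHom hd.symm ≫ f.δ = v := by
  obtain ⟨e, f, hb, hf, ⟨ha, hv⟩, hu⟩ := hs X.e (m.map v ≫ eqToHom X.hd.symm)
  refine ⟨⟨X.c, d, e, ha.trans X.hc, hb⟩,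
    { γ := 𝟙 _, δ := v, μ := f, wc := by simp [hv], wd := ?_ }, rfl, rfl, hf, rfl, by simp⟩
  rw [eqToHom_comp_iff] at hu
  simp [hu]

theorem CocartOnLeft.spanPullback (hs : CocartOnLeft ξ π) :
    CocartOnLeft (spanPbFstC ξ π k m) (spanPbSndD ξ π k m) := by
  intro X c u
  obtain ⟨Y, f, hc, hd, hf, hδ, hu⟩ := hs.exists_lift X u
  have : IsIso f.δ := by rw [hδ]; infer_instance
  exact ⟨Y, f, hc, isOpcartesianMor_spanPbFstC f hf, ⟨hd, hδ⟩, hu⟩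

theorem CartOnRight.spanPullback (hs : CartOnRight ξ π) :
    CartOnRight (spanPbFstC ξ π k m) (spanPbSndD ξ π k m) := by
  intro X d v
  obtain ⟨Y, f, hd, hc, hf, hγ, hv⟩ := hs.exists_lift X v
  have : IsIso f.γ := by rw [hγ]; infer_instance
  exact ⟨Y, f, hd, isCartesianMor_spanPbSndD f hf, ⟨hc, hγ⟩, hv⟩

theorem CocartOnLeft.isOpcartesianMor_μ (hs : CocartOnLeft ξ π) {X Y : SpanPullback ξ π k m}
    (f : X ⟶ Y) (hf : IsOpcartesianMor (spanPbFstC ξ π k m) f) :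
    IsOpcartesianMor ξ f.μ := by
  obtain ⟨Z, g, hc, hd, hg, hδ, hu⟩ := hs.exists_lift X f.γ
  have : IsIso g.δ := by rw [hδ]; infer_instance
  obtain ⟨i, _, rfl⟩ := (isOpcartesianMor_spanPbFstC g hg).exists_isIso hf hc hu
  have : IsIso i.μ := inferInstanceAs (IsIso ((spanPbProjE ξ π k m).map i))
  exact hg.comp_isIso i.μ

theorem CartOnRight.isCartesianMor_μ (hs : CartOnRight ξ π) {X Y : SpanPullback ξ π k m}
    (f : X ⟶ Y) (hf : IsCartesianMor (spanPbSndD ξ π k m) f) :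
    IsCartesianMor π f.μ := by
  obtain ⟨Z, g, hd, hc, hg, hγ, hv⟩ := hs.exists_lift Y f.δ
  have : IsIso g.γ := by rw [hγ]; infer_instance
  obtain ⟨i, _, rfl⟩ := (isCartesianMor_spanPbSndD g hg).exists_isIso hf hd.symm hv
  have : IsIso i.μ := inferInstanceAs (IsIso ((spanPbProjE ξ π k m).map i))
  exact hg.isIso_comp i.μ

theorem IsVerticalMor.spanPullback_left {X Y : SpanPullback ξ π k m} {f : X ⟶ Y}
    (hf : IsVerticalMor (spanPbFstC ξ π k m) f) : IsVerticalMor ξ f.μ := by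
  obtain ⟨h, hf⟩ := hf
  change X.c = Y.c at h
  change f.γ = eqToHom h at hf
  exact ⟨by rw [X.hc, Y.hc, h], by simp [SpanPullbackHom.map_μ_left, hf, eqToHom_map]⟩

theorem IsVerticalMor.spanPullback_right {X Y : SpanPullback ξ π k m} {f : X ⟶ Y}
    (hf : IsVerticalMor (spanPbSndD ξ π k m) f) : IsVerticalMor π f.μ := by
  obtain ⟨h, hf⟩ := hf
  change X.d = Y.d at h
  change f.δ = eqToHom h at hf
  exact ⟨by rw [X.hd, Y.hd, h], by simp [SpanPullbackHom.map_μ_right, hf, eqToHom_map]⟩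

theorem OverSameArrow.spanPullback_left {X Y X' Y' : SpanPullback ξ π k m} {f : X ⟶ Y}
    {g : X' ⟶ Y'} (h : OverSameArrow (spanPbFstC ξ π k m) f g) :
    OverSameArrow ξ f.μ g.μ := by
  obtain ⟨p, q, h⟩ := h
  change X.c = X'.c at p
  change Y.c = Y'.c at q
  change f.γ ≫ eqToHom q = eqToHom p ≫ g.γ at h
  have h' := congrArg (k.map ·) h
  simp only [Functor.map_comp, eqToHom_map, comp_eqToHom_iff] at h'
  exact ⟨by rw [X.hc, X'.hc, p], by rw [Y.hc, Y'.hc, q],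
    by simp [SpanPullbackHom.map_μ_left, h']⟩

theorem OverSameArrow.spanPullback_right {X Y X' Y' : SpanPullback ξ π k m} {f : X ⟶ Y}
    {g : X' ⟶ Y'} (h : OverSameArrow (spanPbSndD ξ π k m) f g) :
    OverSameArrow π f.μ g.μ := by
  obtain ⟨p, q, h⟩ := h
  change X.d = X'.d at p
  change Y.d = Y'.d at q
  change f.δ ≫ eqToHom q = eqToHom p ≫ g.δ at h
  have h' := congrArg (m.map ·) h
  simp only [Functor.map_comp, eqToHom_map, comp_eqToHom_iff] at h'
  exact ⟨by rw [X.hd, X'.hd, p], by rw [Y.hd, Y'.hd, q],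
    by simp [SpanPullbackHom.map_μ_right, h']⟩

theorem IsTwoSidedFib.liftsCommute_spanPullback (hs : IsTwoSidedFib ξ π) :
    LiftsCommute (spanPbFstC ξ π k m) (spanPbSndD ξ π k m) := by
  obtain ⟨hl, hr, hc⟩ := hs
  intro e e₁ e₂ e₃ e₄ a a' f f' g h ha hav ha' hav' hf hfv hfa hf' hfv' hfa' hgv hfg
    hhv hhv' hhf
  have : IsIso h.μ := hc a.μ a'.μ f.μ f'.μ g.μ h.μ
    (hl.isOpcartesianMor_μ a ha) hav.spanPullback_right
    (hr.isCartesianMor_μ a' ha') hav'.spanPullback_left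
    (hl.isOpcartesianMor_μ f hf) hfv.spanPullback_right hfa.spanPullback_left
    (hr.isCartesianMor_μ f' hf') hfv'.spanPullback_left hfa'.spanPullback_right
    hgv.spanPullback_left (congrArg SpanPullbackHom.μ hfg)
    hhv.spanPullback_left hhv'.spanPullback_right (congrArg SpanPullbackHom.μ hhf)
  have : IsIso h.γ := hhv.isIso_map
  have : IsIso h.δ := hhv'.isIso_map
  exact SpanPullbackHom.isIso h

/-- **Pullback stability of two-sided fibrations.** If `⟨ξ,π⟩ : E ⥤ A × B` is a
two-sided fibration and `k : C ⥤ A`, `m : D ⥤ B` are functors, then the span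
`⟨pr_C, pr_D⟩` on the pullback is a two-sided fibration and the projection to `E`,
together with `k` and `m`, is a two-sided cartesian functor. -/
theorem isTwoSidedFib_pullback (h2s : IsTwoSidedFib ξ π) :
    IsTwoSidedFib (spanPbFstC ξ π k m) (spanPbSndD ξ π k m) ∧
    IsTwoSidedCartFunctor (spanPbFstC ξ π k m) (spanPbSndD ξ π k m) ξ π k m
      (spanPbProjE ξ π k m) := by
  refine ⟨⟨h2s.1.spanPullback, h2s.2.1.spanPullback, h2s.liftsCommute_spanPullback⟩, ?_, ?_,
    fun _ _ f hf => h2s.1.isOpcartesianMor_μ f hf,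
    fun _ _ f hf => h2s.2.1.isCartesianMor_μ f hf⟩
  · exact CategoryTheory.Functor.ext (fun X => X.hc.symm) fun X Y f => by
      change k.map f.γ = eqToHom X.hc.symm ≫ ξ.map f.μ ≫ eqToHom Y.hc
      simp [f.wc]
  · exact CategoryTheory.Functor.ext (fun X => X.hd.symm) fun X Y f => by
      change m.map f.δ = eqToHom X.hd.symm ≫ π.map f.μ ≫ eqToHom Y.hd
      simp [f.wd]

end Statement13
end
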